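/- Lemma 2 (uniform exponential integrability of the specification). Fix p ∈ [p₀, q) and α ∈ (α_, ᾱ]. Then: (i) for every λ > 0 and every ξ ∈ L^p(V,w_α) there is a constant C(p,α;λ,ξ) > 0 such that for all finite Λ ⊂ V, ∫_Ω exp(λ‖ω‖_{p,α}^p) π_Λ(dω|ξ) ≤ C(p,α;λ,ξ); (ii) for every λ > 0 there is a constant C(p,α;λ) > 0 such that for every ξ ∈ L^p(V,w_α), limsup over the net of finite sets Λ increasing to V of ∫_Ω exp(λ‖ω‖_{p,α}^p) π_Λ(dω|ξ) is at most C(p,α;λ). -/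

import Mathlib

open MeasureTheory Real Filter

noncomputable section

variable {V : Type} [Countable V] [DecidableEq V]

/-- The configuration equal to `σ` on `Λ` and to `ξ` off `Λ`. -/
def comb (Λ : Finset V) (σ : ↥Λ → ℝ) (ξ : V → ℝ) : V → ℝ :=
  fun x => if h : x ∈ Λ then σ ⟨x, h⟩ else ξ x

/-- The relative local Hamiltonian `H_Λ(·|ξ)`, evaluated at the full configuration
`ω = ω_Λ × ξ_{Λᶜ}`: the sum of `W(ω(x),ω(y))` over edges with both ends in `Λ`,
plus the sum of `W(ω(x),ω(y))` over edges with `x ∈ Λ`, `y ∉ Λ`, plus `Σ_{x∈Λ} V(ω(x))`. -/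
def ham (G : SimpleGraph V) [∀ v : V, Fintype (G.neighborSet v)]
    (W : ℝ → ℝ → ℝ) (P : ℝ → ℝ) (Λ : Finset V) (ω : V → ℝ) : ℝ :=
  (∑ x ∈ Λ, ∑ y ∈ G.neighborFinset x ∩ Λ, W (ω x) (ω y)) / 2
    + ∑ x ∈ Λ, ∑ y ∈ G.neighborFinset x \ Λ, W (ω x) (ω y)
    + ∑ x ∈ Λ, P (ω x)

/-- The normalizing constant `Z_Λ(ξ)`. -/
def partZ (G : SimpleGraph V) [∀ v : V, Fintype (G.neighborSet v)]
    (W : ℝ → ℝ → ℝ) (P : ℝ → ℝ) (Λ : Finset V) (ξ : V → ℝ) : ℝ :=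
  ∫ σ : ↥Λ → ℝ, Real.exp (- ham G W P Λ (comb Λ σ ξ))

/-- The local Gibbs specification kernel `π_Λ(·|ξ)`, a measure on `Ω = ℝ^V`. -/
def gibbsKer (G : SimpleGraph V) [∀ v : V, Fintype (G.neighborSet v)]
    (W : ℝ → ℝ → ℝ) (P : ℝ → ℝ) (Λ : Finset V) (ξ : V → ℝ) : Measure (V → ℝ) :=
  (ENNReal.ofReal (partZ G W P Λ ξ))⁻¹ •
    Measure.map (fun σ => comb Λ σ ξ)
      ((volume : Measure (↥Λ → ℝ)).withDensity
        fun σ => ENNReal.ofReal (Real.exp (- ham G W P Λ (comb Λ σ ξ))))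

/-- `μ` is a Gibbs measure: a probability measure solving the DLR equation. -/
def IsGibbsMeasure (G : SimpleGraph V) [∀ v : V, Fintype (G.neighborSet v)]
    (W : ℝ → ℝ → ℝ) (P : ℝ → ℝ) (μ : Measure (V → ℝ)) : Prop :=
  IsProbabilityMeasure μ ∧
    ∀ (Λ : Finset V) (A : Set (V → ℝ)), MeasurableSet A →
      μ A = ∫⁻ ω, gibbsKer G W P Λ ω A ∂μ

/-- The weight `w_α(x) = exp(-α ρ(o,x))`. -/
def wgt (G : SimpleGraph V) (o : V) (α : ℝ) (x : V) : ℝ :=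
  Real.exp (-α * (G.dist o x : ℝ))

/-- `‖ω‖_{p,α}^p = Σ_{x∈V} |ω(x)|^p w_α(x)`. -/
def sNorm (G : SimpleGraph V) (o : V) (p α : ℝ) (ω : V → ℝ) : ℝ :=
  ∑' x : V, |ω x| ^ p * wgt G o α x

/-- The set `L^p(V, w_α)` of tempered configurations. -/
def tempered (G : SimpleGraph V) (o : V) (p α : ℝ) : Set (V → ℝ) :=
  {ω | Summable fun x : V => |ω x| ^ p * wgt G o α x}

/-- The summability `Θ(α,θ) = Σ_x Σ_{y∼x} [n(x)n(y)]^θ w_α(x) < ∞`. -/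
def ThetaFin (G : SimpleGraph V) [∀ v : V, Fintype (G.neighborSet v)]
    (o : V) (α θ : ℝ) : Prop :=
  Summable fun x : V =>
    (∑ y ∈ G.neighborFinset x, ((G.degree x : ℝ) * (G.degree y : ℝ)) ^ θ) * wgt G o α x


lemma exists_mul_rpow_le_mul_rpow_add {p q a : ℝ} (hp : 0 < p) (hpq : p < q) (ha : 0 < a) (B : ℝ) :
    ∃ K : ℝ, ∀ t : ℝ, 0 ≤ t → B * t ^ p ≤ a * t ^ q + K := by
  set t₀ : ℝ := (|B| / a) ^ (q - p)⁻¹ with ht₀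
  have hBa : 0 ≤ |B| / a := by positivity
  have h0 : 0 ≤ t₀ := by positivity
  refine ⟨|B| * t₀ ^ p, fun t ht => ?_⟩
  have hB : B * t ^ p ≤ |B| * t ^ p := by
    gcongr
    exact le_abs_self B
  refine hB.trans ?_
  rcases le_total t t₀ with h | h
  · have h1 : |B| * t ^ p ≤ |B| * t₀ ^ p := by gcongr
    have h2 : 0 ≤ a * t ^ q := by positivity
    linarith
  · rcases ht.eq_or_lt with rfl | htpos
    · rw [zero_rpow hp.ne', zero_rpow (hp.trans hpq).ne']
      simp only [mul_zero, zero_add]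
      positivity
    have h1 : |B| / a ≤ t ^ (q - p) := by
      have : t₀ ^ (q - p) = |B| / a := by
        rw [ht₀, rpow_inv_rpow hBa (sub_pos.2 hpq).ne']
      rw [← this]
      exact rpow_le_rpow h0 h (sub_pos.2 hpq).le
    have h2 : t ^ q = t ^ (q - p) * t ^ p := by
      rw [← rpow_add htpos]
      ring_nf
    have h3 : |B| ≤ a * t ^ (q - p) := by
      rw [div_le_iff₀ ha] at h1
      linarith
    have h4 : |B| * t ^ p ≤ a * t ^ (q - p) * t ^ p := by gcongr
    have h5 : 0 ≤ |B| * t₀ ^ p := by positivity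
    rw [h2]
    linarith

lemma integrable_exp_mul_rpow_sub_mul_rpow {p q a : ℝ} (hp : 0 < p) (hpq : p < q) (ha : 0 < a)
    (b : ℝ) : Integrable (fun u : ℝ => Real.exp (b * |u| ^ p - a * |u| ^ q)) := by
  obtain ⟨K, hK⟩ := exists_mul_rpow_le_mul_rpow_add hp hpq ha (b + 2 / p)
  refine (integrable_inv_one_add_sq.const_mul (Real.exp (Real.log 2 + K))).mono' ?_ ?_
  · refine Continuous.aestronglyMeasurable ?_
    have h1 : Continuous fun u : ℝ => |u| ^ p :=
      continuous_abs.rpow_const fun _ => Or.inr hp.le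
    have h2 : Continuous fun u : ℝ => |u| ^ q :=
      continuous_abs.rpow_const fun _ => Or.inr (hp.trans hpq).le
    fun_prop
  · refine Eventually.of_forall fun u => ?_
    rw [Real.norm_eq_abs, Real.abs_exp]
    have hpos : (0 : ℝ) < 1 + u ^ 2 := by positivity
    have hlog : Real.log (1 + u ^ 2) ≤ Real.log 2 + 2 / p * |u| ^ p := by
      rcases le_total |u| 1 with h | h
      · have : u ^ 2 ≤ 1 := by rw [← sq_abs]; exact pow_le_one₀ (abs_nonneg u) h
        have h1 : Real.log (1 + u ^ 2) ≤ Real.log 2 := Real.log_le_log hpos (by linarith)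
        have h2 : 0 ≤ 2 / p * |u| ^ p := by positivity
        linarith
      · have h0 : 0 < |u| := by linarith
        have h1 : (1 : ℝ) ≤ |u| ^ 2 := one_le_pow₀ h
        have h2 : Real.log (1 + u ^ 2) ≤ Real.log (2 * |u| ^ 2) :=
          Real.log_le_log hpos (by rw [← sq_abs u]; linarith)
        rw [Real.log_mul (by norm_num) (by positivity), Real.log_pow] at h2
        have h3 := Real.log_le_rpow_div h0.le hp
        have h4 : 2 / p * |u| ^ p = 2 * (|u| ^ p / p) := by ring
        push_cast at h2
        rw [h4]
        linarith
    have h1 := hK |u| (abs_nonneg u)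
    have h2 : b * |u| ^ p - a * |u| ^ q ≤ Real.log 2 + K - Real.log (1 + u ^ 2) := by
      linarith
    calc Real.exp (b * |u| ^ p - a * |u| ^ q)
        ≤ Real.exp (Real.log 2 + K - Real.log (1 + u ^ 2)) := Real.exp_le_exp.2 h2
      _ = _ := by rw [Real.exp_sub, Real.exp_log hpos, div_eq_mul_inv]

lemma mul_rpow_le_rpow_add_rpow {r p : ℝ} (hr : 0 < r) (hrp : r < p) {A t : ℝ}
    (hA : 0 ≤ A) (ht : 0 ≤ t) : A * t ^ r ≤ t ^ p + A ^ (p / (p - r)) := by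
  have hpr : 0 < p - r := sub_pos.2 hrp
  have hp : 0 < p := hr.trans hrp
  have hconj : (p / r).HolderConjugate (p / (p - r)) := by
    rw [Real.holderConjugate_iff]
    refine ⟨(one_lt_div hr).2 hrp, ?_⟩
    field_simp
    ring
  have h := Real.young_inequality_of_nonneg (rpow_nonneg ht r) hA hconj
  rw [← rpow_mul ht, mul_div_cancel₀ _ hr.ne'] at h
  have h1 : t ^ p / (p / r) ≤ t ^ p := div_le_self (by positivity) hconj.lt.le
  have h2 : A ^ (p / (p - r)) / (p / (p - r)) ≤ A ^ (p / (p - r)) :=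
    div_le_self (by positivity) hconj.symm.lt.le
  linarith

/-- Young's inequality with a small coefficient: `k` plays the role of a product of degrees. -/
lemma mul_rpow_le_div_mul_rpow_add {r p θ J γ : ℝ} (hr : 0 < r) (hθ : 0 < θ)
    (hp : r + r / θ ≤ p) (hJ : 0 ≤ J) (hγ : 0 < γ) {k t : ℝ} (hk : 1 ≤ k) (ht : 0 ≤ t) :
    J * t ^ r ≤ γ / k * t ^ p + J ^ (p / (p - r)) * γ⁻¹ ^ (r / (p - r)) * k ^ θ := by
  have hrθ : 0 < r / θ := by positivity
  have hrp : r < p := by linarith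
  have hp0 : 0 < p := by linarith
  have hpr : 0 < p - r := sub_pos.2 hrp
  have hk0 : 0 < k := by linarith
  have hc : 0 < γ / k := by positivity
  have hs : 0 ≤ (γ / k) ^ p⁻¹ * t := by positivity
  have hA : 0 ≤ J * (k / γ) ^ (r / p) := by positivity
  have h := mul_rpow_le_rpow_add_rpow hr hrp hA hs
  have e1 : ((γ / k) ^ p⁻¹ * t) ^ r = (γ / k) ^ (r / p) * t ^ r := by
    rw [mul_rpow (by positivity) ht, ← rpow_mul hc.le]
    congr 2
    field_simp
  have e2 : ((γ / k) ^ p⁻¹ * t) ^ p = γ / k * t ^ p := by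
    rw [mul_rpow (by positivity) ht, rpow_inv_rpow hc.le hp0.ne']
  have e3 : (k / γ) ^ (r / p) * (γ / k) ^ (r / p) = 1 := by
    rw [← mul_rpow (by positivity) hc.le]
    have : k / γ * (γ / k) = 1 := by field_simp
    rw [this, one_rpow]
  have e4 : (J * (k / γ) ^ (r / p)) ^ (p / (p - r))
      = J ^ (p / (p - r)) * γ⁻¹ ^ (r / (p - r)) * k ^ (r / (p - r)) := by
    rw [mul_rpow hJ (by positivity), ← rpow_mul (by positivity)]
    have : r / p * (p / (p - r)) = r / (p - r) := by field_simp
    rw [this, div_eq_mul_inv k γ, mul_rpow hk0.le (by positivity)]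
    ring
  have e5 : k ^ (r / (p - r)) ≤ k ^ θ := by
    refine rpow_le_rpow_of_exponent_le hk ?_
    rw [div_le_iff₀ hpr]
    have : θ * (r / θ) ≤ θ * (p - r) := by gcongr; linarith
    rwa [mul_div_cancel₀ _ hθ.ne'] at this
  rw [e1, e2, e4] at h
  calc J * t ^ r = J * ((k / γ) ^ (r / p) * (γ / k) ^ (r / p)) * t ^ r := by rw [e3, mul_one]
    _ = J * (k / γ) ^ (r / p) * ((γ / k) ^ (r / p) * t ^ r) := by ring
    _ ≤ _ := h
    _ ≤ _ := by gcongr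

lemma lintegral_exp_site_le {ι : Type*} {W : ℝ → ℝ → ℝ} {P : ℝ → ℝ} {IW JW r aV cV p q : ℝ}
    (hJW : 0 < JW) (hr : 0 < r) (hrp : r < p)
    (hW : ∀ u v : ℝ, |W u v| ≤ (IW + JW * (|u| ^ r + |v| ^ r)) / 2)
    (hP : ∀ u : ℝ, aV * |u| ^ q - cV ≤ P u) (lam : ℝ) (s : Finset ι) (f : ι → ℝ) :
    ∫⁻ u, ENNReal.ofReal (Real.exp (lam * |u| ^ p - (∑ y ∈ s, W u (f y) + P u))) ≤
      ENNReal.ofReal (Real.exp (s.card * IW / 2 + JW / 2 * ∑ y ∈ s, |f y| ^ r + cV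
        + JW / 2 * (s.card : ℝ) ^ (p / (p - r)))) *
      ∫⁻ u, ENNReal.ofReal (Real.exp ((lam + JW / 2) * |u| ^ p - aV * |u| ^ q)) := by
  rw [← lintegral_const_mul' _ _ ENNReal.ofReal_ne_top]
  refine lintegral_mono fun u => ?_
  rw [← ENNReal.ofReal_mul (Real.exp_pos _).le, ← Real.exp_add]
  refine ENNReal.ofReal_le_ofReal (Real.exp_le_exp.2 ?_)
  have h1 : -(∑ y ∈ s, W u (f y)) ≤ ∑ y ∈ s, (IW + JW * (|u| ^ r + |f y| ^ r)) / 2 := by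
    rw [← Finset.sum_neg_distrib]
    exact Finset.sum_le_sum fun y _ => (neg_le_abs _).trans (hW _ _)
  have h2 : ∑ y ∈ s, (IW + JW * (|u| ^ r + |f y| ^ r)) / 2
      = s.card * IW / 2 + JW / 2 * (s.card * |u| ^ r) + JW / 2 * ∑ y ∈ s, |f y| ^ r := by
    rw [← Finset.sum_div, Finset.sum_add_distrib, ← Finset.mul_sum, Finset.sum_add_distrib]
    simp only [Finset.sum_const, nsmul_eq_mul]
    ring
  have h3 := mul_rpow_le_rpow_add_rpow hr hrp (Nat.cast_nonneg s.card) (abs_nonneg u)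
  have h4 : JW / 2 * (s.card * |u| ^ r)
      ≤ JW / 2 * (|u| ^ p + (s.card : ℝ) ^ (p / (p - r))) := by gcongr
  have h5 := hP u
  linarith

lemma le_lintegral_exp_site {ι : Type*} {W : ℝ → ℝ → ℝ} {P : ℝ → ℝ} {IW JW r M : ℝ}
    (hJW : 0 < JW) (hr : 0 < r)
    (hW : ∀ u v : ℝ, |W u v| ≤ (IW + JW * (|u| ^ r + |v| ^ r)) / 2)
    (hM : ∀ u ∈ Set.Icc (0 : ℝ) 1, P u ≤ M) (s : Finset ι) (f : ι → ℝ) :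
    ENNReal.ofReal (Real.exp (-(s.card * IW / 2 + JW / 2 * s.card
        + JW / 2 * ∑ y ∈ s, |f y| ^ r + M))) ≤
      ∫⁻ u, ENNReal.ofReal (Real.exp (-(∑ y ∈ s, W u (f y) + P u))) := by
  calc _ = ∫⁻ _ in Set.Icc (0 : ℝ) 1, ENNReal.ofReal (Real.exp (-(s.card * IW / 2
        + JW / 2 * s.card + JW / 2 * ∑ y ∈ s, |f y| ^ r + M))) := by
        rw [setLIntegral_const, Real.volume_Icc]
        simp
    _ ≤ ∫⁻ u in Set.Icc (0 : ℝ) 1,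
          ENNReal.ofReal (Real.exp (-(∑ y ∈ s, W u (f y) + P u))) := by
        refine setLIntegral_mono' measurableSet_Icc fun u hu => ?_
        refine ENNReal.ofReal_le_ofReal (Real.exp_le_exp.2 (neg_le_neg ?_))
        have hu1 : |u| ^ r ≤ 1 :=
          rpow_le_one (abs_nonneg u) (abs_le.2 ⟨by linarith [hu.1], hu.2⟩) hr.le
        have h1 : ∑ y ∈ s, W u (f y) ≤ ∑ y ∈ s, (IW + JW * (1 + |f y| ^ r)) / 2 :=
          Finset.sum_le_sum fun y _ => (le_abs_self _).trans ((hW _ _).trans (by gcongr))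
        have h2 : ∑ y ∈ s, (IW + JW * (1 + |f y| ^ r)) / 2
            = s.card * IW / 2 + JW / 2 * s.card + JW / 2 * ∑ y ∈ s, |f y| ^ r := by
          rw [← Finset.sum_div, Finset.sum_add_distrib, ← Finset.mul_sum, Finset.sum_add_distrib]
          simp only [Finset.sum_const, nsmul_eq_mul]
          ring
        have := hM u hu
        linarith
    _ ≤ _ := setLIntegral_le_lintegral _ _

/-- One-site estimate: `exp (lam |u|^p)` integrated against the conditional density at `x`. -/
lemma exists_lintegral_exp_site_le_mul {V : Type} (G : SimpleGraph V)
    [∀ v : V, Fintype (G.neighborSet v)]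
    {W : ℝ → ℝ → ℝ} {P : ℝ → ℝ} {IW JW r θ aV cV p q : ℝ}
    (hθ : 0 < θ) (hIW : 0 < IW) (hJW : 0 < JW) (hr : 0 < r)
    (hW : ∀ u v : ℝ, |W u v| ≤ (IW + JW * (|u| ^ r + |v| ^ r)) / 2)
    (hPcont : Continuous P) (haV : 0 < aV)
    (hP : ∀ u : ℝ, aV * |u| ^ q - cV ≤ P u) (hp : r + r / θ ≤ p) (hpq : p < q)
    (lam : ℝ) {γ : ℝ} (hγ : 0 < γ) :
    ∃ C : ℝ, 0 ≤ C ∧ ∀ (x : V) (f : V → ℝ),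
      ∫⁻ u, ENNReal.ofReal (Real.exp (lam * |u| ^ p
          - (∑ y ∈ G.neighborFinset x, W u (f y) + P u))) ≤
        ENNReal.ofReal (Real.exp (C * (1 + ∑ y ∈ G.neighborFinset x,
            ((G.degree x : ℝ) * (G.degree y : ℝ)) ^ θ)
          + ∑ y ∈ G.neighborFinset x,
            γ / ((G.degree x : ℝ) * (G.degree y : ℝ)) * |f y| ^ p)) *
        ∫⁻ u, ENNReal.ofReal (Real.exp (-(∑ y ∈ G.neighborFinset x, W u (f y) + P u))) := by
  have hrθ : 0 < r / θ := by positivity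
  have hrp : r < p := by linarith
  have hp0 : 0 < p := by linarith
  have hpr : 0 < p - r := sub_pos.2 hrp
  obtain ⟨M, hM⟩ := (isCompact_Icc (a := (0 : ℝ)) (b := 1)).bddAbove_image hPcont.continuousOn
  have hM' : ∀ u ∈ Set.Icc (0 : ℝ) 1, P u ≤ M := fun u hu => hM ⟨u, hu, rfl⟩
  have hInt := integrable_exp_mul_rpow_sub_mul_rpow hp0 hpq haV (lam + JW / 2)
  set K := ∫ u : ℝ, Real.exp ((lam + JW / 2) * |u| ^ p - aV * |u| ^ q) with hK
  have hKexp : ∫⁻ u, ENNReal.ofReal (Real.exp ((lam + JW / 2) * |u| ^ p - aV * |u| ^ q))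
      ≤ ENNReal.ofReal (Real.exp K) := by
    rw [← ofReal_integral_eq_lintegral_ofReal hInt
      (Eventually.of_forall fun u => (Real.exp_pos _).le)]
    exact ENNReal.ofReal_le_ofReal (by linarith [Real.add_one_le_exp K])
  set D : ℝ := JW ^ (p / (p - r)) * γ⁻¹ ^ (r / (p - r)) with hD
  have hD0 : 0 ≤ D := by positivity
  refine ⟨|cV + M + K| + IW + JW + D, by positivity, fun x f => ?_⟩
  set s := G.neighborFinset x with hs
  have hcard : s.card = G.degree x := G.card_neighborFinset_eq_degree x
  set m : ℝ := ∑ y ∈ s, ((G.degree x : ℝ) * (G.degree y : ℝ)) ^ θ with hm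
  have hdeg : ∀ y ∈ s, (1 : ℝ) ≤ G.degree x ∧ (1 : ℝ) ≤ G.degree y := by
    intro y hy
    rw [hs, SimpleGraph.mem_neighborFinset] at hy
    have h1 : 0 < G.degree x := (G.degree_pos_iff_exists_adj x).2 ⟨y, hy⟩
    have h2 : 0 < G.degree y := (G.degree_pos_iff_exists_adj y).2 ⟨x, hy.symm⟩
    exact ⟨by exact_mod_cast h1, by exact_mod_cast h2⟩
  have hm0 : 0 ≤ m := Finset.sum_nonneg fun y _ => by positivity
  have hcm : (s.card : ℝ) ≤ m := by
    rw [← nsmul_one, ← Finset.sum_const]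
    refine Finset.sum_le_sum fun y hy => one_le_rpow ?_ hθ.le
    nlinarith [(hdeg y hy).1, (hdeg y hy).2]
  have hcm' : (s.card : ℝ) ^ (p / (p - r)) ≤ m := by
    rcases Finset.eq_empty_or_nonempty s with h | ⟨y₀, hy₀⟩
    · rw [h, Finset.card_empty, Nat.cast_zero, zero_rpow (by positivity)]
      exact hm0
    · have hd1 := (hdeg y₀ hy₀).1
      have hexp : p / (p - r) ≤ 1 + θ := by
        rw [div_le_iff₀ hpr]
        have : θ * (r / θ) ≤ θ * (p - r) := by gcongr; linarith
        rw [mul_div_cancel₀ _ hθ.ne'] at this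
        linarith
      calc (s.card : ℝ) ^ (p / (p - r)) ≤ (s.card : ℝ) ^ (1 + θ) := by
            rw [hcard]
            exact rpow_le_rpow_of_exponent_le hd1 hexp
        _ = ∑ y ∈ s, (G.degree x : ℝ) ^ θ := by
            rw [Finset.sum_const, nsmul_eq_mul, hcard, rpow_add (by linarith), rpow_one]
        _ ≤ m := by
            refine Finset.sum_le_sum fun y hy => ?_
            refine rpow_le_rpow (by positivity) ?_ hθ.le
            nlinarith [(hdeg y hy).2]
  have hS : JW * ∑ y ∈ s, |f y| ^ r ≤
      ∑ y ∈ s, γ / ((G.degree x : ℝ) * (G.degree y : ℝ)) * |f y| ^ p + D * m := by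
    rw [Finset.mul_sum, hm, Finset.mul_sum, ← Finset.sum_add_distrib]
    refine Finset.sum_le_sum fun y hy => ?_
    refine mul_rpow_le_div_mul_rpow_add hr hθ hp hJW.le hγ ?_ (abs_nonneg _)
    nlinarith [(hdeg y hy).1, (hdeg y hy).2]
  have hup := lintegral_exp_site_le (p := p) hJW hr hrp hW hP lam s f
  have hlow := le_lintegral_exp_site hJW hr hW hM' s f
  refine hup.trans ((mul_le_mul_right hKexp _).trans (le_trans ?_ (mul_le_mul_right hlow _)))
  rw [← ENNReal.ofReal_mul (Real.exp_pos _).le, ← ENNReal.ofReal_mul (Real.exp_pos _).le,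
    ← Real.exp_add, ← Real.exp_add]
  refine ENNReal.ofReal_le_ofReal (Real.exp_le_exp.2 ?_)
  have e1 : IW * s.card ≤ IW * m := by gcongr
  have e2 : JW * s.card ≤ JW * m := by gcongr
  have e3 : JW * (s.card : ℝ) ^ (p / (p - r)) ≤ JW * m := by gcongr
  have e4 : cV + M + K ≤ |cV + M + K| := le_abs_self _
  have e5 : 0 ≤ |cV + M + K| * m := by positivity
  nlinarith

lemma double_sum_eq_two_mul {ι : Type*} [DecidableEq ι] (s : Finset ι) {x : ι} (hx : x ∈ s)
    (E : ι → ι → ℝ) (hsymm : ∀ a b, E a b = E b a) (hxx : E x x = 0)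
    (hE : ∀ a b, a ≠ x → b ≠ x → E a b = 0) :
    ∑ a ∈ s, ∑ b ∈ s, E a b = 2 * ∑ b ∈ s, E x b := by
  have h : ∀ a ∈ s.erase x, ∑ b ∈ s, E a b = E x a := by
    intro a ha
    rw [Finset.sum_eq_single x (fun b _ hb => hE a b (Finset.ne_of_mem_erase ha) hb)
      (fun h => absurd hx h), hsymm]
  rw [← Finset.add_sum_erase s _ hx, Finset.sum_congr rfl h,
    ← Finset.add_sum_erase s (fun b => E x b) hx, hxx]
  ring

lemma ham_update_sub_ham_update {V : Type} [DecidableEq V] (G : SimpleGraph V)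
    [∀ v : V, Fintype (G.neighborSet v)]
    {W : ℝ → ℝ → ℝ} (hWsym : ∀ u v : ℝ, W u v = W v u) (P : ℝ → ℝ) {Λ : Finset V} {x : V}
    (hx : x ∈ Λ) (ω : V → ℝ) (u v : ℝ) :
    ham G W P Λ (Function.update ω x u) - ham G W P Λ (Function.update ω x v) =
      (∑ y ∈ G.neighborFinset x, W u (ω y) + P u)
        - (∑ y ∈ G.neighborFinset x, W v (ω y) + P v) := by
  classical
  set D : V → V → ℝ := fun a b =>
    W (Function.update ω x u a) (Function.update ω x u b)
      - W (Function.update ω x v a) (Function.update ω x v b) with hD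
  have hDne : ∀ a b, a ≠ x → b ≠ x → D a b = 0 := by
    intro a b ha hb
    simp [hD, ha, hb]
  have hDx : ∀ b, b ≠ x → D x b = W u (ω b) - W v (ω b) := by
    intro b hb
    simp [hD, hb]
  have hnx : ∀ b ∈ G.neighborFinset x, b ≠ x := by
    intro b hb
    rw [SimpleGraph.mem_neighborFinset] at hb
    exact hb.ne'
  have hin : ∑ a ∈ Λ, ∑ b ∈ G.neighborFinset a ∩ Λ, D a b
      = 2 * ∑ b ∈ G.neighborFinset x ∩ Λ, D x b := by
    have key : ∀ a, ∑ b ∈ G.neighborFinset a ∩ Λ, D a b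
        = ∑ b ∈ Λ, if G.Adj a b then D a b else 0 := by
      intro a
      rw [← Finset.sum_filter]
      refine Finset.sum_congr ?_ fun _ _ => rfl
      ext b
      simp [and_comm]
    simp_rw [key]
    refine double_sum_eq_two_mul Λ hx _ (fun a b => ?_) (by simp) (fun a b ha hb => ?_)
    · simp only [G.adj_comm a b, hD, hWsym (Function.update ω x u a),
        hWsym (Function.update ω x v a)]
    · simp [hDne a b ha hb]
  have hout : ∑ a ∈ Λ, ∑ b ∈ G.neighborFinset a \ Λ, D a b
      = ∑ b ∈ G.neighborFinset x \ Λ, D x b := by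
    refine Finset.sum_eq_single x (fun a _ ha => Finset.sum_eq_zero fun b hb => ?_)
      (fun h => absurd hx h)
    refine hDne a b ha ?_
    rintro rfl
    exact (Finset.mem_sdiff.1 hb).2 hx
  have hpot : ∑ a ∈ Λ, (P (Function.update ω x u a) - P (Function.update ω x v a))
      = P u - P v := by
    rw [Finset.sum_eq_single x (fun a _ ha => by simp [ha]) (fun h => absurd hx h)]
    simp
  have hsplit : ∑ b ∈ G.neighborFinset x ∩ Λ, D x b + ∑ b ∈ G.neighborFinset x \ Λ, D x b
      = ∑ y ∈ G.neighborFinset x, W u (ω y) - ∑ y ∈ G.neighborFinset x, W v (ω y) := by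
    rw [Finset.sum_inter_add_sum_sdiff, ← Finset.sum_sub_distrib]
    exact Finset.sum_congr rfl fun b hb => hDx b (hnx b hb)
  simp only [hD, Finset.sum_sub_distrib] at hin hout hpot hsplit
  unfold ham
  linarith

lemma comb_apply_of_mem {V : Type} [DecidableEq V] {Λ : Finset V} {x : V} (hx : x ∈ Λ)
    (σ : ↥Λ → ℝ) (ξ : V → ℝ) : comb Λ σ ξ x = σ ⟨x, hx⟩ := dif_pos hx

lemma comb_apply_of_notMem {V : Type} [DecidableEq V] {Λ : Finset V} {x : V} (hx : x ∉ Λ)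
    (σ : ↥Λ → ℝ) (ξ : V → ℝ) : comb Λ σ ξ x = ξ x := dif_neg hx

lemma comb_update {V : Type} [DecidableEq V] {Λ : Finset V} (x : ↥Λ)
    (σ : ↥Λ → ℝ) (ξ : V → ℝ) (u : ℝ) :
    comb Λ (Function.update σ x u) ξ = Function.update (comb Λ σ ξ) x u := by
  ext y
  by_cases hy : y ∈ Λ
  · rw [comb_apply_of_mem hy]
    by_cases hyx : y = x
    · subst hyx
      simp
    · rw [Function.update_of_ne hyx, comb_apply_of_mem hy, Function.update_of_ne]
      exact fun h => hyx (congrArg Subtype.val h)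
  · rw [comb_apply_of_notMem hy, Function.update_of_ne, comb_apply_of_notMem hy]
    rintro rfl
    exact hy x.2

lemma continuous_comb_apply {V : Type} [DecidableEq V] (Λ : Finset V) (ξ : V → ℝ) (x : V) :
    Continuous fun σ : ↥Λ → ℝ => comb Λ σ ξ x := by
  by_cases hx : x ∈ Λ
  · simp only [comb_apply_of_mem hx]
    fun_prop
  · simp only [comb_apply_of_notMem hx]
    fun_prop

lemma continuous_comb {V : Type} [DecidableEq V] (Λ : Finset V) (ξ : V → ℝ) :
    Continuous fun σ : ↥Λ → ℝ => comb Λ σ ξ :=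
  continuous_pi fun x => continuous_comb_apply Λ ξ x

lemma continuous_ham_comb {V : Type} [DecidableEq V] (G : SimpleGraph V)
    [∀ v : V, Fintype (G.neighborSet v)] {W : ℝ → ℝ → ℝ} {P : ℝ → ℝ}
    (hWcont : Continuous (Function.uncurry W)) (hPcont : Continuous P) (Λ : Finset V)
    (ξ : V → ℝ) : Continuous fun σ : ↥Λ → ℝ => ham G W P Λ (comb Λ σ ξ) := by
  have hW : ∀ x y, Continuous fun σ : ↥Λ → ℝ => W (comb Λ σ ξ x) (comb Λ σ ξ y) := fun x y =>
    hWcont.comp ((continuous_comb_apply Λ ξ x).prodMk (continuous_comb_apply Λ ξ y))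
  have hP : ∀ x, Continuous fun σ : ↥Λ → ℝ => P (comb Λ σ ξ x) := fun x =>
    hPcont.comp (continuous_comb_apply Λ ξ x)
  unfold ham
  exact (((continuous_finsetSum _ fun x _ => continuous_finsetSum _ fun y _ => hW x y).div_const
    2).add (continuous_finsetSum _ fun x _ => continuous_finsetSum _ fun y _ => hW x y)).add
    (continuous_finsetSum _ fun x _ => hP x)

/-- Coercivity of the local Hamiltonian, with constants depending on `Λ` and `ξ`. -/
lemma exists_neg_ham_comb_le {V : Type} [DecidableEq V] (G : SimpleGraph V)
    [∀ v : V, Fintype (G.neighborSet v)] {W : ℝ → ℝ → ℝ} {P : ℝ → ℝ} {IW JW r aV cV p q : ℝ}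
    (hIW : 0 < IW) (hJW : 0 < JW) (hr : 0 < r) (hrp : r < p)
    (hW : ∀ u v : ℝ, |W u v| ≤ (IW + JW * (|u| ^ r + |v| ^ r)) / 2)
    (hP : ∀ u : ℝ, aV * |u| ^ q - cV ≤ P u) (Λ : Finset V) (ξ : V → ℝ) :
    ∃ K B : ℝ, ∀ σ : ↥Λ → ℝ, -ham G W P Λ (comb Λ σ ξ)
      ≤ K + ∑ x : ↥Λ, (B * |σ x| ^ p - aV * |σ x| ^ q) := by
  set T : ℝ := ∑ a ∈ Λ, ∑ b ∈ G.neighborFinset a, |ξ b| ^ r with hT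
  have hT0 : 0 ≤ T := Finset.sum_nonneg fun a _ => Finset.sum_nonneg fun b _ => by positivity
  set N₁ : ℝ := ∑ a ∈ Λ, ((G.neighborFinset a ∩ Λ).card : ℝ) with hN₁
  set N₂ : ℝ := ∑ a ∈ Λ, ((G.neighborFinset a \ Λ).card : ℝ) with hN₂
  have hN₁0 : 0 ≤ N₁ := Finset.sum_nonneg fun a _ => by positivity
  have hN₂0 : 0 ≤ N₂ := Finset.sum_nonneg fun a _ => by positivity
  refine ⟨(N₁ + N₂) * (IW + JW * T) + Λ.card * cV + (N₁ + N₂) * JW * Λ.card,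
    (N₁ + N₂) * JW, fun σ => ?_⟩
  set ω := comb Λ σ ξ with hω
  set M : ℝ := ∑ a ∈ Λ, |ω a| ^ r with hM
  have hM0 : 0 ≤ M := Finset.sum_nonneg fun a _ => by positivity
  have hin : ∀ a ∈ Λ, |ω a| ^ r ≤ M + T := fun a ha =>
    (Finset.single_le_sum (f := fun a => |ω a| ^ r) (fun b _ => by positivity) ha).trans
      (le_add_of_nonneg_right hT0)
  have hnb : ∀ a ∈ Λ, ∀ b ∈ G.neighborFinset a, |ω b| ^ r ≤ M + T := by
    intro a ha b hb
    by_cases hbΛ : b ∈ Λ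
    · exact hin b hbΛ
    · rw [hω, comb_apply_of_notMem hbΛ]
      have h1 : |ξ b| ^ r ≤ ∑ b ∈ G.neighborFinset a, |ξ b| ^ r :=
        Finset.single_le_sum (f := fun b => |ξ b| ^ r) (fun b _ => by positivity) hb
      have h2 : ∑ b ∈ G.neighborFinset a, |ξ b| ^ r ≤ T :=
        Finset.single_le_sum (f := fun a => ∑ b ∈ G.neighborFinset a, |ξ b| ^ r)
          (fun a _ => Finset.sum_nonneg fun b _ => by positivity) ha
      linarith
  set Q : ℝ := IW + JW * (M + T) with hQ
  have hQ0 : 0 ≤ Q := by positivity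
  have hWQ : ∀ a ∈ Λ, ∀ b ∈ G.neighborFinset a, -Q ≤ W (ω a) (ω b) := by
    intro a ha b hb
    have h1 := (abs_le.1 (hW (ω a) (ω b))).1
    have h2 : JW * (|ω a| ^ r + |ω b| ^ r) ≤ JW * ((M + T) + (M + T)) := by
      have := hin a ha
      have := hnb a ha b hb
      gcongr
    rw [hQ]
    linarith
  have hs₁ : -(N₁ * Q) ≤ ∑ a ∈ Λ, ∑ b ∈ G.neighborFinset a ∩ Λ, W (ω a) (ω b) := by
    rw [hN₁, Finset.sum_mul, ← Finset.sum_neg_distrib]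
    refine Finset.sum_le_sum fun a ha => ?_
    rw [← mul_neg, ← nsmul_eq_mul]
    exact Finset.card_nsmul_le_sum _ _ _ fun b hb => hWQ a ha b (Finset.mem_inter.1 hb).1
  have hs₂ : -(N₂ * Q) ≤ ∑ a ∈ Λ, ∑ b ∈ G.neighborFinset a \ Λ, W (ω a) (ω b) := by
    rw [hN₂, Finset.sum_mul, ← Finset.sum_neg_distrib]
    refine Finset.sum_le_sum fun a ha => ?_
    rw [← mul_neg, ← nsmul_eq_mul]
    exact Finset.card_nsmul_le_sum _ _ _ fun b hb => hWQ a ha b (Finset.mem_sdiff.1 hb).1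
  have hs₃ : aV * ∑ a ∈ Λ, |ω a| ^ q - Λ.card * cV ≤ ∑ a ∈ Λ, P (ω a) := by
    rw [Finset.mul_sum, ← nsmul_eq_mul, ← Finset.sum_const, ← Finset.sum_sub_distrib]
    exact Finset.sum_le_sum fun a _ => hP _
  have hMp : M ≤ Λ.card + ∑ a ∈ Λ, |ω a| ^ p := by
    rw [hM, ← nsmul_one, ← Finset.sum_const, ← Finset.sum_add_distrib]
    refine Finset.sum_le_sum fun a _ => ?_
    have := mul_rpow_le_rpow_add_rpow hr hrp zero_le_one (abs_nonneg (ω a))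
    rw [one_mul, one_rpow] at this
    linarith
  have hsum : ∑ x : ↥Λ, ((N₁ + N₂) * JW * |σ x| ^ p - aV * |σ x| ^ q)
      = (N₁ + N₂) * JW * ∑ a ∈ Λ, |ω a| ^ p - aV * ∑ a ∈ Λ, |ω a| ^ q := by
    rw [Finset.mul_sum, Finset.mul_sum, ← Finset.sum_sub_distrib, ← Finset.sum_coe_sort Λ]
    refine Finset.sum_congr rfl fun x _ => ?_
    rw [hω, comb_apply_of_mem x.2]
  have hJ : (N₁ + N₂) * JW * M ≤ (N₁ + N₂) * JW * (Λ.card + ∑ a ∈ Λ, |ω a| ^ p) :=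
    mul_le_mul_of_nonneg_left hMp (mul_nonneg (add_nonneg hN₁0 hN₂0) hJW.le)
  have hNQ : 0 ≤ N₁ * Q := mul_nonneg hN₁0 hQ0
  rw [hsum]
  unfold ham
  rw [hQ] at hs₁ hs₂ hNQ
  linarith

lemma integrable_exp_sum_sub_ham {V : Type} [DecidableEq V] (G : SimpleGraph V)
    [∀ v : V, Fintype (G.neighborSet v)] {W : ℝ → ℝ → ℝ} {P : ℝ → ℝ} {IW JW r aV cV p q : ℝ}
    (hWcont : Continuous (Function.uncurry W)) (hPcont : Continuous P)
    (hIW : 0 < IW) (hJW : 0 < JW) (hr : 0 < r) (hrp : r < p) (hpq : p < q) (haV : 0 < aV)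
    (hW : ∀ u v : ℝ, |W u v| ≤ (IW + JW * (|u| ^ r + |v| ^ r)) / 2)
    (hP : ∀ u : ℝ, aV * |u| ^ q - cV ≤ P u) (lam : ℝ) (Λ : Finset V) (ξ : V → ℝ) :
    Integrable fun σ : ↥Λ → ℝ =>
      Real.exp (lam * ∑ x, |σ x| ^ p - ham G W P Λ (comb Λ σ ξ)) := by
  have hp : 0 < p := hr.trans hrp
  obtain ⟨K, B, hKB⟩ := exists_neg_ham_comb_le G hIW hJW hr hrp hW hP Λ ξ
  have hprod : Integrable fun σ : ↥Λ → ℝ =>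
      ∏ x, Real.exp ((lam + B) * |σ x| ^ p - aV * |σ x| ^ q) :=
    Integrable.fintype_prod (f := fun (_ : ↥Λ) (u : ℝ) =>
        Real.exp ((lam + B) * |u| ^ p - aV * |u| ^ q))
      fun _ => integrable_exp_mul_rpow_sub_mul_rpow hp hpq haV (lam + B)
  refine (hprod.const_mul (Real.exp K)).mono' ?_ (Eventually.of_forall fun σ => ?_)
  · have h1 := continuous_ham_comb G hWcont hPcont Λ ξ
    have h2 : ∀ x : ↥Λ, Continuous fun σ : ↥Λ → ℝ => |σ x| ^ p := fun x =>
      (continuous_apply x).abs.rpow_const fun _ => Or.inr hp.le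
    exact Continuous.aestronglyMeasurable (by fun_prop)
  · rw [Real.norm_eq_abs, Real.abs_exp, ← Real.exp_sum, ← Real.exp_add]
    refine Real.exp_le_exp.2 ?_
    have h := hKB σ
    simp only [add_mul, add_sub_assoc, Finset.sum_add_distrib, ← Finset.mul_sum] at h ⊢
    linarith

/-- The law of the restriction to `Λ` under the local Gibbs specification. -/
def localGibbs {V : Type} [DecidableEq V] (G : SimpleGraph V)
    [∀ v : V, Fintype (G.neighborSet v)] (W : ℝ → ℝ → ℝ) (P : ℝ → ℝ) (Λ : Finset V)
    (ξ : V → ℝ) : Measure (↥Λ → ℝ) :=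
  (ENNReal.ofReal (partZ G W P Λ ξ))⁻¹ •
    (volume : Measure (↥Λ → ℝ)).withDensity
      fun σ => ENNReal.ofReal (Real.exp (- ham G W P Λ (comb Λ σ ξ)))

lemma lintegral_gibbsKer_le {V : Type} [DecidableEq V] (G : SimpleGraph V)
    [∀ v : V, Fintype (G.neighborSet v)] (W : ℝ → ℝ → ℝ) (P : ℝ → ℝ) (Λ : Finset V)
    (ξ : V → ℝ) (F : (V → ℝ) → ENNReal) :
    ∫⁻ ω, F ω ∂(gibbsKer G W P Λ ξ) ≤ ∫⁻ σ, F (comb Λ σ ξ) ∂(localGibbs G W P Λ ξ) := by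
  unfold gibbsKer localGibbs
  rw [lintegral_smul_measure, lintegral_smul_measure]
  exact mul_le_mul_right (lintegral_map_le _ _) _

lemma lintegral_localGibbs {V : Type} [DecidableEq V] (G : SimpleGraph V)
    [∀ v : V, Fintype (G.neighborSet v)] {W : ℝ → ℝ → ℝ} {P : ℝ → ℝ}
    (hWcont : Continuous (Function.uncurry W)) (hPcont : Continuous P)
    (Λ : Finset V) (ξ : V → ℝ) {g : (↥Λ → ℝ) → ℝ} (hg : Continuous g) :
    ∫⁻ σ, ENNReal.ofReal (Real.exp (g σ)) ∂(localGibbs G W P Λ ξ) =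
      (ENNReal.ofReal (partZ G W P Λ ξ))⁻¹ *
        ∫⁻ σ : ↥Λ → ℝ, ENNReal.ofReal (Real.exp (g σ - ham G W P Λ (comb Λ σ ξ))) := by
  have h1 := (continuous_ham_comb G hWcont hPcont Λ ξ).measurable
  unfold localGibbs
  rw [lintegral_smul_measure, lintegral_withDensity_eq_lintegral_mul _ (by fun_prop) (by fun_prop),
    smul_eq_mul]
  congr 1
  refine lintegral_congr fun σ => ?_
  rw [Pi.mul_apply, ← ENNReal.ofReal_mul (Real.exp_pos _).le, ← Real.exp_add]
  congr 2
  ring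

lemma isProbabilityMeasure_localGibbs {V : Type} [DecidableEq V] (G : SimpleGraph V)
    [∀ v : V, Fintype (G.neighborSet v)] {W : ℝ → ℝ → ℝ} {P : ℝ → ℝ}
    (hWcont : Continuous (Function.uncurry W)) (hPcont : Continuous P)
    (Λ : Finset V) (ξ : V → ℝ)
    (hInt : Integrable fun σ : ↥Λ → ℝ => Real.exp (-ham G W P Λ (comb Λ σ ξ))) :
    IsProbabilityMeasure (localGibbs G W P Λ ξ) := by
  have hZ : ENNReal.ofReal (partZ G W P Λ ξ)
      = ∫⁻ σ : ↥Λ → ℝ, ENNReal.ofReal (Real.exp (-ham G W P Λ (comb Λ σ ξ))) :=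
    ofReal_integral_eq_lintegral_ofReal hInt (Eventually.of_forall fun _ => (Real.exp_pos _).le)
  have hpos : 0 < partZ G W P Λ ξ := integral_exp_pos hInt
  refine ⟨?_⟩
  have h := lintegral_localGibbs G hWcont hPcont Λ ξ (g := fun _ => 0) continuous_const
  simp only [Real.exp_zero, ENNReal.ofReal_one, lintegral_one, zero_sub] at h
  rw [h, ← hZ]
  exact ENNReal.inv_mul_cancel (by simpa using hpos) ENNReal.ofReal_ne_top

lemma lintegral_localGibbs_site_le {V : Type} [DecidableEq V] (G : SimpleGraph V)
    [∀ v : V, Fintype (G.neighborSet v)] {W : ℝ → ℝ → ℝ} {P : ℝ → ℝ}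
    (hWcont : Continuous (Function.uncurry W)) (hWsym : ∀ u v : ℝ, W u v = W v u)
    (hPcont : Continuous P) {p lam A : ℝ} (hp : 0 < p) {x : V} {c : V → ℝ}
    (hsite : ∀ f : V → ℝ,
      ∫⁻ u, ENNReal.ofReal (Real.exp (lam * |u| ^ p
          - (∑ y ∈ G.neighborFinset x, W u (f y) + P u))) ≤
        ENNReal.ofReal (Real.exp (A + ∑ y ∈ G.neighborFinset x, c y * |f y| ^ p)) *
        ∫⁻ u, ENNReal.ofReal (Real.exp (-(∑ y ∈ G.neighborFinset x, W u (f y) + P u))))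
    {Λ : Finset V} (hx : x ∈ Λ) (ξ : V → ℝ) :
    ∫⁻ σ, ENNReal.ofReal (Real.exp (lam * |comb Λ σ ξ x| ^ p)) ∂(localGibbs G W P Λ ξ) ≤
      ∫⁻ σ, ENNReal.ofReal (Real.exp (A + ∑ y ∈ G.neighborFinset x, c y * |comb Λ σ ξ y| ^ p))
        ∂(localGibbs G W P Λ ξ) := by
  have hc : ∀ y, Continuous fun σ : ↥Λ → ℝ => |comb Λ σ ξ y| ^ p := fun y =>
    (continuous_comb_apply Λ ξ y).abs.rpow_const fun _ => Or.inr hp.le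
  have hh := continuous_ham_comb G hWcont hPcont Λ ξ
  rw [lintegral_localGibbs G hWcont hPcont Λ ξ (by fun_prop),
    lintegral_localGibbs G hWcont hPcont Λ ξ (by fun_prop)]
  refine mul_le_mul_right ?_ _
  refine lintegral_le_of_lmarginal_le (μ := fun _ : ↥Λ => (volume : Measure ℝ)) {⟨x, hx⟩}
    (by fun_prop) (by fun_prop) ?_
  rw [lmarginal_singleton, lmarginal_singleton]
  intro σ
  simp only [comb_update]
  set ω := comb Λ σ ξ with hω
  set H₀ : ℝ := ham G W P Λ (Function.update ω x 0)
    - (∑ y ∈ G.neighborFinset x, W 0 (ω y) + P 0) with hH₀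
  have hham : ∀ u, ham G W P Λ (Function.update ω x u)
      = (∑ y ∈ G.neighborFinset x, W u (ω y) + P u) + H₀ := by
    intro u
    have := ham_update_sub_ham_update G hWsym P hx ω u 0
    rw [hH₀]
    linarith
  have hoff : ∀ u, ∑ y ∈ G.neighborFinset x, c y * |Function.update ω x u y| ^ p
      = ∑ y ∈ G.neighborFinset x, c y * |ω y| ^ p := by
    intro u
    refine Finset.sum_congr rfl fun y hy => ?_
    rw [SimpleGraph.mem_neighborFinset] at hy
    rw [Function.update_of_ne hy.ne']
  simp only [hham, hoff, Function.update_self]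
  have e1 : ∀ a b : ℝ, ENNReal.ofReal (Real.exp (a - (b + H₀)))
      = ENNReal.ofReal (Real.exp (-H₀)) * ENNReal.ofReal (Real.exp (a - b)) := by
    intro a b
    rw [← ENNReal.ofReal_mul (Real.exp_pos _).le, ← Real.exp_add]
    congr 2
    ring
  have e2 : ∀ a b : ℝ, ENNReal.ofReal (Real.exp (a - b))
      = ENNReal.ofReal (Real.exp a) * ENNReal.ofReal (Real.exp (-b)) := by
    intro a b
    rw [← ENNReal.ofReal_mul (Real.exp_pos _).le, ← Real.exp_add, sub_eq_add_neg]
  simp only [e1]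
  rw [lintegral_const_mul' _ _ ENNReal.ofReal_ne_top,
    lintegral_const_mul' _ _ ENNReal.ofReal_ne_top]
  refine mul_le_mul_right ?_ _
  simp only [e2 (A + _)]
  rw [lintegral_const_mul' _ _ ENNReal.ofReal_ne_top]
  exact hsite ω

lemma lintegral_exp_sum_mul_le {α ι : Type*} [MeasurableSpace α] {ν : Measure α}
    [IsProbabilityMeasure ν] (s : Finset ι) {X : ι → α → ℝ} {c n : ι → ℝ}
    (hX : ∀ i ∈ s, Measurable (X i)) (hc : ∀ i ∈ s, 0 ≤ c i) (hc1 : ∑ i ∈ s, c i ≤ 1)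
    (hn : ∀ i ∈ s, ∫⁻ a, ENNReal.ofReal (Real.exp (X i a)) ∂ν ≤ ENNReal.ofReal (Real.exp (n i))) :
    ∫⁻ a, ENNReal.ofReal (Real.exp (∑ i ∈ s, c i * X i a)) ∂ν
      ≤ ENNReal.ofReal (Real.exp (∑ i ∈ s, c i * n i)) := by
  have hexp : ∀ t : ι → ℝ, ENNReal.ofReal (Real.exp (∑ i ∈ s, c i * t i))
      = ∏ i ∈ s, ENNReal.ofReal (Real.exp (t i)) ^ c i := by
    intro t
    rw [Real.exp_sum, ENNReal.ofReal_prod_of_nonneg fun _ _ => (Real.exp_pos _).le]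
    refine Finset.prod_congr rfl fun i hi => ?_
    rw [ENNReal.ofReal_rpow_of_nonneg (Real.exp_pos _).le (hc i hi), ← Real.exp_mul, mul_comm]
  have h := ENNReal.lintegral_mul_prod_norm_pow_le (μ := ν) s (g := fun _ => 1)
    (f := fun i a => ENNReal.ofReal (Real.exp (X i a))) aemeasurable_const
    (fun i hi => ((hX i hi).exp.ennreal_ofReal).aemeasurable) (1 - ∑ i ∈ s, c i) (p := c)
    (by ring) (by linarith) hc
  simp only [ENNReal.one_rpow, one_mul, lintegral_one, measure_univ] at h
  simp only [hexp]
  exact h.trans (Finset.prod_le_prod' fun i hi => ENNReal.rpow_le_rpow (hn i hi) (hc i hi))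

lemma lintegral_localGibbs_exp_lt_top {V : Type} [DecidableEq V] (G : SimpleGraph V)
    [∀ v : V, Fintype (G.neighborSet v)] {W : ℝ → ℝ → ℝ} {P : ℝ → ℝ} {p lam : ℝ}
    (hWcont : Continuous (Function.uncurry W)) (hPcont : Continuous P) (hp : 0 < p)
    (hlam : 0 ≤ lam) {Λ : Finset V} (ξ : V → ℝ)
    (hInt₀ : Integrable fun σ : ↥Λ → ℝ => Real.exp (-ham G W P Λ (comb Λ σ ξ)))
    (hInt : Integrable fun σ : ↥Λ → ℝ =>
      Real.exp (lam * ∑ x, |σ x| ^ p - ham G W P Λ (comb Λ σ ξ))) {x : V} (hx : x ∈ Λ) :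
    ∫⁻ σ, ENNReal.ofReal (Real.exp (lam * |comb Λ σ ξ x| ^ p)) ∂(localGibbs G W P Λ ξ) < ⊤ := by
  have hc : Continuous fun σ : ↥Λ → ℝ => |comb Λ σ ξ x| ^ p :=
    (continuous_comb_apply Λ ξ x).abs.rpow_const fun _ => Or.inr hp.le
  have hpos : 0 < partZ G W P Λ ξ := integral_exp_pos hInt₀
  rw [lintegral_localGibbs G hWcont hPcont Λ ξ (by fun_prop)]
  refine ENNReal.mul_lt_top (ENNReal.inv_lt_top.2 (ENNReal.ofReal_pos.2 hpos))
    (lt_of_le_of_lt (lintegral_mono fun σ => ?_) hInt.lintegral_lt_top)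
  refine ENNReal.ofReal_le_ofReal (Real.exp_le_exp.2 (sub_le_sub_right ?_ _))
  refine mul_le_mul_of_nonneg_left ?_ hlam
  rw [comb_apply_of_mem hx]
  exact Finset.single_le_sum (f := fun y : ↥Λ => |σ y| ^ p) (fun y _ => by positivity)
    (Finset.mem_univ (⟨x, hx⟩ : ↥Λ))

lemma wgt_pos {V : Type} (G : SimpleGraph V) (o : V) (α : ℝ) (x : V) : 0 < wgt G o α x :=
  Real.exp_pos _

lemma wgt_le_of_adj {V : Type} {G : SimpleGraph V} (o : V) (α : ℝ) {x y : V} (h : G.Adj x y) :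
    wgt G o α x ≤ Real.exp |α| * wgt G o α y := by
  unfold wgt
  rw [← Real.exp_add]
  refine Real.exp_le_exp.2 ?_
  have hd : |(G.dist o y : ℝ) - G.dist o x| ≤ 1 := by
    rcases h.diff_dist_adj (u := o) with h | h | h
    · simp [h]
    · simp [h]
    · rcases Nat.eq_zero_or_pos (G.dist o x) with h0 | h0
      · simp [h, h0]
      · rw [h, Nat.cast_sub h0]
        simp
  have h1 : α * ((G.dist o y : ℝ) - G.dist o x) ≤ |α| := by
    refine (le_abs_self _).trans ?_
    rw [abs_mul]
    exact mul_le_of_le_one_right (abs_nonneg _) hd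
  linarith

lemma sum_inv_degree_mul_degree_le_one {V : Type} (G : SimpleGraph V)
    [∀ v : V, Fintype (G.neighborSet v)] (x : V) {s : Finset V} (hs : s ⊆ G.neighborFinset x) :
    ∑ y ∈ s, ((G.degree x : ℝ) * (G.degree y : ℝ))⁻¹ ≤ 1 := by
  have h1 : ∀ y ∈ s, ((G.degree x : ℝ) * (G.degree y : ℝ))⁻¹ ≤ (G.degree x : ℝ)⁻¹ := by
    intro y hy
    have hadj := (SimpleGraph.mem_neighborFinset _ _ _).1 (hs hy)
    have hx : 0 < G.degree x := (G.degree_pos_iff_exists_adj x).2 ⟨y, hadj⟩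
    have hy : 0 < G.degree y := (G.degree_pos_iff_exists_adj y).2 ⟨x, hadj.symm⟩
    have hx' : (0 : ℝ) < G.degree x := by exact_mod_cast hx
    have hy' : (1 : ℝ) ≤ G.degree y := by exact_mod_cast hy
    exact inv_anti₀ hx' (le_mul_of_one_le_right hx'.le hy')
  calc _ ≤ s.card • (G.degree x : ℝ)⁻¹ := Finset.sum_le_card_nsmul _ _ _ h1
    _ ≤ (G.degree x : ℝ) * (G.degree x : ℝ)⁻¹ := by
        rw [nsmul_eq_mul]
        gcongr
        rw [← G.card_neighborFinset_eq_degree x]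
        exact Finset.card_le_card hs
    _ ≤ 1 := mul_inv_le_one

/-- Solving the system of linear inequalities satisfied by the exponential moments. -/
lemma sum_wgt_mul_le {V : Type} [DecidableEq V] (G : SimpleGraph V)
    [∀ v : V, Fintype (G.neighborSet v)] (o : V) {α κ C T : ℝ} (hC : 0 ≤ C) (hκ0 : 0 ≤ κ)
    (hκ : κ * Real.exp |α| = 1 / 2) (Λ : Finset V) {n D : V → ℝ} (hn0 : ∀ x, 0 ≤ n x)
    (hD0 : ∀ x, 0 ≤ D x) (hD : Summable fun x => D x * wgt G o α x)
    (hn : ∀ x ∈ Λ, n x ≤ C * D x + ∑ y ∈ G.neighborFinset x,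
      κ / ((G.degree x : ℝ) * (G.degree y : ℝ)) * n y)
    (hT : ∀ F : Finset V, ∑ x ∈ F \ Λ, n x * wgt G o α x ≤ T) :
    ∑ x ∈ Λ, n x * wgt G o α x ≤ 2 * C * ∑' x, D x * wgt G o α x + T := by
  have hw := wgt_pos G o α
  set S := ∑ x ∈ Λ, n x * wgt G o α x with hS
  have h1 : S ≤ C * ∑ x ∈ Λ, D x * wgt G o α x + 1 / 2 * ∑ x ∈ Λ, ∑ y ∈ G.neighborFinset x,
      ((G.degree x : ℝ) * (G.degree y : ℝ))⁻¹ * (n y * wgt G o α y) := by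
    rw [Finset.mul_sum, Finset.mul_sum, ← Finset.sum_add_distrib]
    refine Finset.sum_le_sum fun x hx => ?_
    refine (mul_le_mul_of_nonneg_right (hn x hx) (hw x).le).trans ?_
    rw [add_mul, mul_assoc, Finset.sum_mul, Finset.mul_sum]
    refine add_le_add le_rfl (Finset.sum_le_sum fun y hy => ?_)
    have hadj := wgt_le_of_adj o α ((SimpleGraph.mem_neighborFinset _ _ _).1 hy)
    have h0 : 0 ≤ κ / ((G.degree x : ℝ) * (G.degree y : ℝ)) * n y :=
      mul_nonneg (by positivity) (hn0 y)
    refine (mul_le_mul_of_nonneg_left hadj h0).trans (le_of_eq ?_)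
    rw [← hκ]
    ring
  have h2 : ∑ x ∈ Λ, ∑ y ∈ G.neighborFinset x,
      ((G.degree x : ℝ) * (G.degree y : ℝ))⁻¹ * (n y * wgt G o α y) ≤ S + T := by
    set F := Λ.biUnion fun x => G.neighborFinset x with hF
    rw [Finset.sum_comm' (s' := fun y => G.neighborFinset y ∩ Λ) (t' := F)]
    · have h3 : ∀ y ∈ F, ∑ x ∈ G.neighborFinset y ∩ Λ,
          ((G.degree x : ℝ) * (G.degree y : ℝ))⁻¹ * (n y * wgt G o α y) ≤ n y * wgt G o α y := by
        intro y _
        rw [← Finset.sum_mul]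
        refine mul_le_of_le_one_left (mul_nonneg (hn0 y) (hw y).le) ?_
        simp only [mul_comm (G.degree _ : ℝ) (G.degree y : ℝ)]
        exact sum_inv_degree_mul_degree_le_one G y Finset.inter_subset_left
      refine (Finset.sum_le_sum h3).trans ?_
      rw [← Finset.sum_inter_add_sum_sdiff F Λ]
      refine add_le_add ?_ (hT F)
      exact Finset.sum_le_sum_of_subset_of_nonneg Finset.inter_subset_right
        fun x _ _ => mul_nonneg (hn0 x) (hw x).le
    · intro x y
      simp only [hF, Finset.mem_biUnion, Finset.mem_inter, SimpleGraph.mem_neighborFinset]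
      constructor
      · rintro ⟨hx, hxy⟩
        exact ⟨⟨hxy.symm, hx⟩, x, hx, hxy⟩
      · rintro ⟨⟨hyx, hx⟩, -⟩
        exact ⟨hx, hyx.symm⟩
  have h3 : C * ∑ x ∈ Λ, D x * wgt G o α x ≤ C * ∑' x, D x * wgt G o α x :=
    mul_le_mul_of_nonneg_left
      (hD.sum_le_tsum Λ fun x _ => mul_nonneg (hD0 x) (hw x).le) hC
  linarith

lemma summable_wgt_of_thetaFin {V : Type} (G : SimpleGraph V)
    [∀ v : V, Fintype (G.neighborSet v)] (hconn : G.Connected) (o : V) {α θ : ℝ} (hθ : 0 < θ)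
    (h : ThetaFin G o α θ) : Summable fun x => wgt G o α x := by
  rcases subsingleton_or_nontrivial V with hV | hV
  · exact Summable.of_finite
  · refine Summable.of_nonneg_of_le (fun x => (wgt_pos G o α x).le) (fun x => ?_) h
    refine le_mul_of_one_le_left (wgt_pos G o α x).le ?_
    have hx : 0 < G.degree x := hconn.preconnected.degree_pos_of_nontrivial x
    obtain ⟨y, hy⟩ := (G.degree_pos_iff_exists_adj x).1 hx
    have hy' : 0 < G.degree y := (G.degree_pos_iff_exists_adj y).2 ⟨x, hy.symm⟩
    refine le_trans ?_ (Finset.single_le_sum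
      (f := fun y => ((G.degree x : ℝ) * (G.degree y : ℝ)) ^ θ) (fun z _ => by positivity)
      ((SimpleGraph.mem_neighborFinset _ _ _).2 hy))
    refine one_le_rpow ?_ hθ.le
    exact_mod_cast Nat.mul_pos hx hy'

lemma sNorm_comb {V : Type} [DecidableEq V] (G : SimpleGraph V) (o : V) {p α : ℝ} {ξ : V → ℝ}
    (hξ : ξ ∈ tempered G o p α) (Λ : Finset V) (σ : ↥Λ → ℝ) :
    sNorm G o p α (comb Λ σ ξ) = ∑ x ∈ Λ, wgt G o α x * |comb Λ σ ξ x| ^ p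
      + (sNorm G o p α ξ - ∑ x ∈ Λ, |ξ x| ^ p * wgt G o α x) := by
  have h1 : HasSum (fun x => |ξ x| ^ p * wgt G o α x) (sNorm G o p α ξ) := Summable.hasSum hξ
  have h2 : HasSum (fun x => |comb Λ σ ξ x| ^ p * wgt G o α x - |ξ x| ^ p * wgt G o α x)
      (∑ x ∈ Λ, (|comb Λ σ ξ x| ^ p * wgt G o α x - |ξ x| ^ p * wgt G o α x)) :=
    hasSum_sum_of_ne_finset_zero fun x hx => by rw [comb_apply_of_notMem hx, sub_self]
  have h3 := (h2.add h1).tsum_eq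
  simp only [sub_add_cancel] at h3
  rw [sNorm, h3, Finset.sum_sub_distrib]
  simp only [mul_comm (wgt G o α _)]
  ring

/-- Exponential moments of the specification, in terms of the boundary condition off `Λ` only. -/
lemma exists_lintegral_exp_sNorm_le {V : Type} [DecidableEq V] (G : SimpleGraph V)
    [∀ v : V, Fintype (G.neighborSet v)] (hconn : G.Connected) (o : V)
    {W : ℝ → ℝ → ℝ} {P : ℝ → ℝ} {IW JW r θ aV cV p q α : ℝ}
    (hθ : 0 < θ) (hΘ : ThetaFin G o α θ) (hWcont : Continuous (Function.uncurry W))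
    (hWsym : ∀ u v : ℝ, W u v = W v u) (hIW : 0 < IW) (hJW : 0 < JW) (hr : 0 < r)
    (hW : ∀ u v : ℝ, |W u v| ≤ (IW + JW * (|u| ^ r + |v| ^ r)) / 2)
    (hPcont : Continuous P) (haV : 0 < aV)
    (hP : ∀ u : ℝ, aV * |u| ^ q - cV ≤ P u) (hp : r + r / θ ≤ p) (hpq : p < q)
    {lam : ℝ} (hlam : 0 < lam) :
    ∃ A B : ℝ, 0 ≤ B ∧ ∀ ξ ∈ tempered G o p α, ∀ Λ : Finset V,
      ∫⁻ ω, ENNReal.ofReal (Real.exp (lam * sNorm G o p α ω)) ∂(gibbsKer G W P Λ ξ) ≤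
        ENNReal.ofReal (Real.exp
          (A + B * (sNorm G o p α ξ - ∑ x ∈ Λ, |ξ x| ^ p * wgt G o α x))) := by
  have hrθ : 0 < r / θ := by positivity
  have hrp : r < p := by linarith
  have hp0 : 0 < p := by linarith
  have hw := wgt_pos G o α
  have hws := summable_wgt_of_thetaFin G hconn o hθ hΘ
  set w : ℝ := ∑' x, wgt G o α x with hwdef
  have hw0 : 0 < w := hws.tsum_pos (fun x => (hw x).le) o (hw o)
  set μ : ℝ := lam * w with hμ
  have hμ0 : 0 < μ := by positivity
  set κ : ℝ := Real.exp (-|α|) / 2 with hκ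
  have hκ0 : 0 < κ := by positivity
  have hκ1 : κ ≤ 1 := by
    have : Real.exp (-|α|) ≤ 1 := Real.exp_le_one_iff.2 (by simp)
    linarith
  have hκα : κ * Real.exp |α| = 1 / 2 := by
    rw [hκ, div_mul_eq_mul_div, ← Real.exp_add, neg_add_cancel, Real.exp_zero]
  set D : V → ℝ := fun x =>
    1 + ∑ y ∈ G.neighborFinset x, ((G.degree x : ℝ) * (G.degree y : ℝ)) ^ θ with hDdef
  have hD0 : ∀ x, 0 ≤ D x := fun x =>
    add_nonneg zero_le_one (Finset.sum_nonneg fun y _ => by positivity)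
  have hD : Summable fun x => D x * wgt G o α x := by
    simp only [hDdef, add_mul, one_mul]
    exact hws.add hΘ
  obtain ⟨C, hC, hsite⟩ := exists_lintegral_exp_site_le_mul G hθ hIW hJW hr hW hPcont haV hP hp hpq
    μ (γ := κ * μ) (by positivity)
  refine ⟨lam / μ * (2 * C * ∑' x, D x * wgt G o α x), lam / μ * μ + lam, by positivity,
    fun ξ hξ Λ => ?_⟩
  set T : ℝ := sNorm G o p α ξ - ∑ x ∈ Λ, |ξ x| ^ p * wgt G o α x with hT
  have hInt := fun l => integrable_exp_sum_sub_ham G hWcont hPcont hIW hJW hr hrp hpq haV hW hP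
    l Λ ξ
  have hInt₀ : Integrable fun σ : ↥Λ → ℝ => Real.exp (-ham G W P Λ (comb Λ σ ξ)) := by
    simpa using hInt 0
  have hprob := isProbabilityMeasure_localGibbs G hWcont hPcont Λ ξ hInt₀
  set ν := localGibbs G W P Λ ξ with hν
  have hexists : ∀ x, ∃ n : ℝ, 0 ≤ n ∧
      ∫⁻ σ, ENNReal.ofReal (Real.exp (μ * |comb Λ σ ξ x| ^ p)) ∂ν = ENNReal.ofReal (Real.exp n) ∧
      (x ∉ Λ → n = μ * |ξ x| ^ p) := by
    intro x
    by_cases hx : x ∈ Λ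
    · have hlt := lintegral_localGibbs_exp_lt_top G hWcont hPcont hp0 hμ0.le ξ hInt₀ (hInt μ) hx
      set L := ∫⁻ σ, ENNReal.ofReal (Real.exp (μ * |comb Λ σ ξ x| ^ p)) ∂ν with hL
      have hge : 1 ≤ L := by
        calc (1 : ENNReal) = ∫⁻ _, 1 ∂ν := by simp
          _ ≤ L := lintegral_mono fun σ =>
            ENNReal.one_le_ofReal.2 (Real.one_le_exp (by positivity))
      have hge' : 1 ≤ L.toReal := by
        simpa using ENNReal.toReal_mono hlt.ne hge
      refine ⟨Real.log L.toReal, Real.log_nonneg hge', ?_, fun h => absurd hx h⟩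
      rw [Real.exp_log (by linarith), ENNReal.ofReal_toReal hlt.ne]
    · refine ⟨μ * |ξ x| ^ p, by positivity, ?_, fun _ => rfl⟩
      simp [comb_apply_of_notMem hx]
  choose n hn0 hnL hnoff using hexists
  have hmeas : ∀ x, Measurable fun σ : ↥Λ → ℝ => μ * |comb Λ σ ξ x| ^ p := fun x =>
    (continuous_const.mul
      ((continuous_comb_apply Λ ξ x).abs.rpow_const fun _ => Or.inr hp0.le)).measurable
  have hrec : ∀ x ∈ Λ, n x ≤ C * D x + ∑ y ∈ G.neighborFinset x,
      κ / ((G.degree x : ℝ) * (G.degree y : ℝ)) * n y := by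
    intro x hx
    have h1 := lintegral_localGibbs_site_le G hWcont hWsym hPcont hp0 (hsite x) hx ξ
    have h2 := lintegral_exp_sum_mul_le (ν := ν) (G.neighborFinset x)
      (X := fun y σ => μ * |comb Λ σ ξ y| ^ p)
      (c := fun y => κ / ((G.degree x : ℝ) * (G.degree y : ℝ))) (n := n)
      (fun y _ => hmeas y) (fun y _ => by positivity)
      (by
        simp only [div_eq_mul_inv κ, ← Finset.mul_sum]
        exact mul_le_one₀ hκ1 (Finset.sum_nonneg fun y _ => by positivity)
          (sum_inv_degree_mul_degree_le_one G x subset_rfl))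
      (fun y _ => (hnL y).le)
    have h3 : ∀ y (t : ℝ), κ * μ / ((G.degree x : ℝ) * (G.degree y : ℝ)) * t
        = κ / ((G.degree x : ℝ) * (G.degree y : ℝ)) * (μ * t) := fun y t => by ring
    simp only [Real.exp_add, ENNReal.ofReal_mul (Real.exp_pos _).le, h3] at h1
    rw [lintegral_const_mul' _ _ ENNReal.ofReal_ne_top, hnL x] at h1
    have h4 := h1.trans (mul_le_mul_right h2 _)
    rw [← ENNReal.ofReal_mul (Real.exp_pos _).le, ← Real.exp_add,
      ENNReal.ofReal_le_ofReal_iff (Real.exp_pos _).le] at h4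
    exact Real.exp_le_exp.1 h4
  have hoff : ∀ F : Finset V, ∑ x ∈ F \ Λ, n x * wgt G o α x ≤ μ * T := by
    intro F
    have h1 : ∑ x ∈ F \ Λ, n x * wgt G o α x = μ * ∑ x ∈ F \ Λ, |ξ x| ^ p * wgt G o α x := by
      rw [Finset.mul_sum]
      refine Finset.sum_congr rfl fun x hx => ?_
      rw [hnoff x (Finset.mem_sdiff.1 hx).2]
      ring
    have h2 : ∑ x ∈ Λ ∪ F \ Λ, |ξ x| ^ p * wgt G o α x ≤ sNorm G o p α ξ :=
      Summable.sum_le_tsum _ (fun x _ => mul_nonneg (by positivity) (hw x).le) hξ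
    rw [Finset.sum_union Finset.disjoint_sdiff] at h2
    rw [h1]
    exact mul_le_mul_of_nonneg_left (by linarith) hμ0.le
  have hsum := sum_wgt_mul_le G o hC hκ0.le hκα Λ hn0 hD0 hD hrec hoff
  have hfin := lintegral_exp_sum_mul_le (ν := ν) Λ (X := fun y σ => μ * |comb Λ σ ξ y| ^ p)
    (c := fun x => lam / μ * wgt G o α x) (n := n) (fun y _ => hmeas y)
    (fun y _ => mul_nonneg (by positivity) (hw y).le)
    (by
      rw [← Finset.mul_sum, div_mul_eq_mul_div, div_le_one hμ0, hμ]
      exact mul_le_mul_of_nonneg_left (hws.sum_le_tsum Λ fun x _ => (hw x).le) hlam.le)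
    (fun y _ => (hnL y).le)
  refine (lintegral_gibbsKer_le G W P Λ ξ _).trans ?_
  have hsplit : ∀ σ : ↥Λ → ℝ, lam * sNorm G o p α (comb Λ σ ξ)
      = lam * T + ∑ x ∈ Λ, lam / μ * wgt G o α x * (μ * |comb Λ σ ξ x| ^ p) := by
    intro σ
    rw [sNorm_comb G o hξ, mul_add, Finset.mul_sum, add_comm]
    congr 1
    refine Finset.sum_congr rfl fun x _ => ?_
    field_simp
  simp only [hsplit, Real.exp_add (lam * T), ENNReal.ofReal_mul (Real.exp_pos _).le]
  rw [lintegral_const_mul' _ _ ENNReal.ofReal_ne_top]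
  refine (mul_le_mul_right hfin _).trans ?_
  rw [← ENNReal.ofReal_mul (Real.exp_pos _).le, ← Real.exp_add]
  refine ENNReal.ofReal_le_ofReal (Real.exp_le_exp.2 ?_)
  have h1 : ∑ x ∈ Λ, lam / μ * wgt G o α x * n x = lam / μ * ∑ x ∈ Λ, n x * wgt G o α x := by
    rw [Finset.mul_sum]
    exact Finset.sum_congr rfl fun x _ => by ring
  have h2 : lam / μ * ∑ x ∈ Λ, n x * wgt G o α x
      ≤ lam / μ * (2 * C * ∑' x, D x * wgt G o α x + μ * T) :=
    mul_le_mul_of_nonneg_left hsum (by positivity)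
  rw [h1]
  linarith

/-- **Lemma 2 (uniform exponential integrability of the specification).**
Fix `p ∈ [p₀,q)` and `α ∈ (α_,ᾱ]`. Then:
(i) for every `λ > 0` and `ξ ∈ L^p(V,w_α)` there is `C(p,α;λ,ξ) > 0` such that for all
finite `Λ`: `∫ exp(λ‖ω‖_{p,α}^p) π_Λ(dω|ξ) ≤ C(p,α;λ,ξ)`;
(ii) for every `λ > 0` there is `C(p,α;λ) > 0` such that for all `ξ ∈ L^p(V,w_α)`:
`limsup_{Λ ↑ V} ∫ exp(λ‖ω‖_{p,α}^p) π_Λ(dω|ξ) ≤ C(p,α;λ)`. -/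
theorem uniform_exponential_integrability_of_specification
    (G : SimpleGraph V) [∀ v : V, Fintype (G.neighborSet v)] (hconn : G.Connected)
    (o : V) (θ : ℝ) (hθ : 0 < θ)
    (αlow αbar : ℝ) (hαlow : αlow = sInf {α : ℝ | ThetaFin G o α θ})
    (hbar : αlow < αbar) (hΘ : ∀ α ∈ Set.Ioc αlow αbar, ThetaFin G o α θ)
    (W : ℝ → ℝ → ℝ) (hWcont : Continuous (Function.uncurry W))
    (hWsym : ∀ u v : ℝ, W u v = W v u)
    (IW JW r : ℝ) (hIW : 0 < IW) (hJW : 0 < JW) (hr : 0 < r)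
    (hW : ∀ u v : ℝ, |W u v| ≤ (IW + JW * (|u| ^ r + |v| ^ r)) / 2)
    (P : ℝ → ℝ) (hPcont : Continuous P)
    (aV cV q : ℝ) (haV : 0 < aV) (hcV : 0 < cV) (hq : r + r / θ < q)
    (hP : ∀ u : ℝ, aV * |u| ^ q - cV ≤ P u)
    (p α : ℝ) (hp : p ∈ Set.Ico (r + r / θ) q) (hα : α ∈ Set.Ioc αlow αbar) :
    (∀ lam : ℝ, 0 < lam → ∀ ξ ∈ tempered G o p α, ∃ C : ℝ, 0 < C ∧
      ∀ Λ : Finset V,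
        ∫⁻ ω, ENNReal.ofReal (Real.exp (lam * sNorm G o p α ω)) ∂(gibbsKer G W P Λ ξ) ≤
          ENNReal.ofReal C) ∧
    (∀ lam : ℝ, 0 < lam → ∃ C : ℝ, 0 < C ∧ ∀ ξ ∈ tempered G o p α,
      Filter.limsup
        (fun Λ : Finset V =>
          ∫⁻ ω, ENNReal.ofReal (Real.exp (lam * sNorm G o p α ω)) ∂(gibbsKer G W P Λ ξ))
        Filter.atTop ≤ ENNReal.ofReal C) := by
  have key := fun (lam : ℝ) (hlam : 0 < lam) =>
    exists_lintegral_exp_sNorm_le G hconn o hθ (hΘ α hα) hWcont hWsym hIW hJW hr hW hPcont haV hP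
      hp.1 hp.2 hlam
  have hw := wgt_pos G o α
  refine ⟨fun lam hlam ξ hξ => ?_, fun lam hlam => ?_⟩
  · obtain ⟨A, B, hB, h⟩ := key lam hlam
    refine ⟨Real.exp (A + B * sNorm G o p α ξ), Real.exp_pos _, fun Λ => (h ξ hξ Λ).trans ?_⟩
    refine ENNReal.ofReal_le_ofReal (Real.exp_le_exp.2 ?_)
    have : 0 ≤ ∑ x ∈ Λ, |ξ x| ^ p * wgt G o α x :=
      Finset.sum_nonneg fun x _ => mul_nonneg (by positivity) (hw x).le
    gcongr
    linarith
  · obtain ⟨A, B, hB, h⟩ := key lam hlam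
    refine ⟨Real.exp (A + B), Real.exp_pos _, fun ξ hξ => ?_⟩
    refine Filter.limsup_le_of_le (by isBoundedDefault) ?_
    have hsum : HasSum (fun x => |ξ x| ^ p * wgt G o α x) (sNorm G o p α ξ) := Summable.hasSum hξ
    have hev : ∀ᶠ Λ : Finset V in Filter.atTop,
        sNorm G o p α ξ - 1 < ∑ x ∈ Λ, |ξ x| ^ p * wgt G o α x :=
      Tendsto.eventually_const_lt (sub_one_lt _) hsum
    filter_upwards [hev] with Λ hΛ
    refine (h ξ hξ Λ).trans (ENNReal.ofReal_le_ofReal (Real.exp_le_exp.2 ?_))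
    have : B * (sNorm G o p α ξ - ∑ x ∈ Λ, |ξ x| ^ p * wgt G o α x) ≤ B * 1 :=
      mul_le_mul_of_nonneg_left (by linarith) hB
    linarith
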